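/- (Discrete dynamic programming principle, measurable selector.) Let A ⊂ ℝ^{d×d} be a nonempty compact set and let g : (0,∞)^d → ℝ be continuous, nonnegative and of polynomial growth. Then for every 0 ≤ n ≤ N−1 there exists a Borel measurable function α_n^⋆ : (0,∞)^d → A such that for every x ∈ (0,∞)^d, V_n(x) = ∫_{ℝ^d} e^{−rT/N} V_{n+1}(F(x, α_n^⋆(x), z)) dγ_d(z); in particular, there exists an optimal Markov policy and it is deterministic. -/

import Mathlib

open MeasureTheory ProbabilityTheory Matrix

/-- The Borel measurable-space structure on matrices (the product σ-algebra). -/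
instance matrixMeasurableSpace (d : ℕ) : MeasurableSpace (Matrix (Fin d) (Fin d) ℝ) :=
  (inferInstance : MeasurableSpace (Fin d → Fin d → ℝ))

/-- The log-Euler scheme map `F(x, a, ξ)^i = x^i exp((r - (aaᵀ)^{ii}/2) T/N + √(T/N) (aξ)^i)`. -/
noncomputable def logEuler (d : ℕ) (T r : ℝ) (N : ℕ)
    (x : Fin d → ℝ) (a : Matrix (Fin d) (Fin d) ℝ) (ξ : Fin d → ℝ) : Fin d → ℝ :=
  fun i => x i * Real.exp ((r - (1 / 2) * (a * aᵀ) i i) * (T / N)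
    + Real.sqrt (T / N) * a.mulVec ξ i)

/-- The standard Gaussian measure `N(0, I_d)` on `ℝ^d`. -/
noncomputable def stdGaussian (d : ℕ) : Measure (Fin d → ℝ) :=
  Measure.pi fun _ => gaussianReal 0 1

/-- A stochastic Markov policy with values in the admissible set `A`: a sequence of Borel
Markov kernels from the state space to the action space, each placing full mass on `A`. -/
def IsPolicy {d : ℕ} (A : Set (Matrix (Fin d) (Fin d) ℝ))
    (π : ℕ → Kernel (Fin d → ℝ) (Matrix (Fin d) (Fin d) ℝ)) : Prop :=
  ∀ k, IsMarkovKernel (π k) ∧ ∀ x : Fin d → ℝ, (π k) x A = 1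

/-- The expected terminal payoff `E^π[g(X_N) | X_{N-m} = x]` of the controlled log-Euler
chain under the stochastic Markov policy `π`, written (via Ionescu–Tulcea/Fubini) as an
iterated integral over actions and Gaussian innovations; `m` is the number of remaining
steps, so time is `n = N - m`. -/
noncomputable def polPay (d : ℕ) (T r : ℝ) (N : ℕ) (g : (Fin d → ℝ) → ℝ)
    (π : ℕ → Kernel (Fin d → ℝ) (Matrix (Fin d) (Fin d) ℝ)) :
    ℕ → (Fin d → ℝ) → ℝ
  | 0 => g
  | m + 1 => fun x =>
      ∫ a, ∫ z, polPay d T r N g π m (logEuler d T r N x a z)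
        ∂(stdGaussian d) ∂((π (N - (m + 1))) x)

/-- The value function `V_n(x) = sup_π E^π[e^{-r(T - nT/N)} g(X_N) | X_n = x]`, the
supremum over all stochastic Markov policies valued in `A` of the discounted expected
terminal payoff. -/
noncomputable def valueFn (d : ℕ) (T r : ℝ) (N : ℕ) (g : (Fin d → ℝ) → ℝ)
    (A : Set (Matrix (Fin d) (Fin d) ℝ)) (n : ℕ) (x : Fin d → ℝ) : ℝ :=
  sSup {v : ℝ | ∃ π : ℕ → Kernel (Fin d → ℝ) (Matrix (Fin d) (Fin d) ℝ),
    IsPolicy A π ∧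
    v = Real.exp (-(r * (T - (n : ℝ) * T / N))) * polPay d T r N g π (N - n) x}



section helpers
open Set Filter Topology

/-- Compact-valued random set, measurable in the sense of hitting closed sets. -/
def GoodSet {Ω β : Type*} [MeasurableSpace Ω] [TopologicalSpace β] (K : Ω → Set β) : Prop :=
  (∀ x, IsCompact (K x)) ∧ (∀ x, (K x).Nonempty) ∧
    ∀ C, IsClosed C → MeasurableSet {x | (K x ∩ C).Nonempty}

lemma GoodSet.argmin {Ω β : Type*} [MeasurableSpace Ω] [TopologicalSpace β]
    {K : Ω → Set β} (hK : GoodSet K) {c : β → ℝ} (hc : Continuous c) :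
    GoodSet (fun x => {a | a ∈ K x ∧ ∀ b ∈ K x, c a ≤ c b}) := by
  obtain ⟨h1, h2, h3⟩ := hK
  refine ⟨fun x => ?_, fun x => ?_, fun C hC => ?_⟩
  · have : {a | a ∈ K x ∧ ∀ b ∈ K x, c a ≤ c b} = K x ∩ ⋂ b ∈ K x, {a | c a ≤ c b} := by
      ext a; simp
    simp only [this]
    exact (h1 x).inter_right (isClosed_biInter fun b _ => isClosed_le hc continuous_const)
  · obtain ⟨a, ha, hm⟩ := (h1 x).exists_isMinOn (h2 x) hc.continuousOn
    exact ⟨a, ha, fun b hb => hm hb⟩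
  · have : {x | ({a | a ∈ K x ∧ ∀ b ∈ K x, c a ≤ c b} ∩ C).Nonempty} =
        ⋂ q : ℚ, ({x | (K x ∩ {a | c a ≤ q}).Nonempty}ᶜ ∪
          {x | (K x ∩ (C ∩ {a | c a ≤ q})).Nonempty}) := by
      ext x
      simp only [mem_ofPred_eq, mem_iInter, mem_union, mem_compl_iff]
      constructor
      · rintro ⟨a, ⟨ha, hm⟩, haC⟩ q
        by_cases h : (K x ∩ {a | c a ≤ q}).Nonempty
        · right
          obtain ⟨b, hb, hbq⟩ := h
          exact ⟨a, ha, haC, (hm b hb).trans hbq⟩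
        · exact Or.inl h
      · intro h
        have key : ∀ b ∈ K x, ∀ q : ℚ, c b ≤ q → (K x ∩ (C ∩ {a | c a ≤ q})).Nonempty := by
          intro b hb q hq
          rcases h q with h | h
          · exact absurd ⟨b, hb, hq⟩ h
          · exact h
        have hne : (K x ∩ C).Nonempty := by
          obtain ⟨b, hb⟩ := h2 x
          obtain ⟨q, hq⟩ := exists_rat_gt (c b)
          obtain ⟨a, ha, haC, _⟩ := key b hb q hq.le
          exact ⟨a, ha, haC⟩
        obtain ⟨a, ha, hm⟩ := ((h1 x).inter_right hC).exists_isMinOn hne hc.continuousOn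
        refine ⟨a, ⟨ha.1, fun b hb => ?_⟩, ha.2⟩
        by_contra! hlt
        obtain ⟨q, hq1, hq2⟩ := exists_rat_btwn hlt
        obtain ⟨a', ha', haC', haq⟩ := key b hb q hq1.le
        have : c a ≤ c a' := hm ⟨ha', haC'⟩
        have : c a' ≤ q := haq
        linarith
    rw [this]
    exact MeasurableSet.iInter fun q =>
      (h3 _ (isClosed_le hc continuous_const)).compl.union
        (h3 _ (hC.inter (isClosed_le hc continuous_const)))

lemma GoodSet.refine_list {Ω β : Type*} [MeasurableSpace Ω] [TopologicalSpace β]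
    {K : Ω → Set β} (hK : GoodSet K) {ι : Type*} (c : ι → β → ℝ) (hc : ∀ i, Continuous (c i))
    (l : List ι) : ∃ K' : Ω → Set β, GoodSet K' ∧ (∀ x, K' x ⊆ K x) ∧
      ∀ i ∈ l, ∀ x, ∀ a ∈ K' x, ∀ b ∈ K' x, c i a = c i b := by
  induction l with
  | nil => exact ⟨K, hK, fun _ => le_rfl, by simp⟩
  | cons j l ih =>
    obtain ⟨K', h1, h2, h3⟩ := ih
    refine ⟨_, h1.argmin (hc j), fun x a ha => h2 x ha.1, ?_⟩
    intro i hi x a ha b hb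
    rcases List.mem_cons.1 hi with rfl | hi
    · exact le_antisymm (ha.2 b hb.1) (hb.2 a ha.1)
    · exact h3 i hi x a ha.1 b hb.1

instance matrixBorelAux (d : ℕ) : BorelSpace (Matrix (Fin d) (Fin d) ℝ) :=
  inferInstanceAs (BorelSpace (Fin d → Fin d → ℝ))

instance matrixSingletonAux (d : ℕ) : MeasurableSingletonClass (Matrix (Fin d) (Fin d) ℝ) :=
  inferInstanceAs (MeasurableSingletonClass (Fin d → Fin d → ℝ))

instance matrixFirstCountableAux (d : ℕ) :
    FirstCountableTopology (Matrix (Fin d) (Fin d) ℝ) :=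
  inferInstanceAs (FirstCountableTopology (Fin d → Fin d → ℝ))

lemma GoodSet.selector {Ω : Type*} [MeasurableSpace Ω] {d : ℕ}
    {K : Ω → Set (Matrix (Fin d) (Fin d) ℝ)} (hK : GoodSet K) :
    ∃ α : Ω → Matrix (Fin d) (Fin d) ℝ, Measurable α ∧ ∀ x, α x ∈ K x := by
  obtain ⟨K', ⟨_, h2, h3⟩, h4, h5⟩ := hK.refine_list
    (fun (q : Fin d × Fin d) (a : Matrix (Fin d) (Fin d) ℝ) => a q.1 q.2)
    (fun q => by fun_prop) Finset.univ.toList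
  have h6 : ∀ x, ∀ a ∈ K' x, ∀ b ∈ K' x, a = b := by
    intro x a ha b hb
    ext i j
    exact h5 (i, j) (by simp) x a ha b hb
  choose α hα using h2
  refine ⟨α, measurable_of_isClosed fun C hC => ?_, fun x => h4 x (hα x)⟩
  convert h3 C hC using 1
  ext x
  constructor
  · intro hx; exact ⟨α x, hα x, hx⟩
  · rintro ⟨a, ha, haC⟩
    rw [mem_preimage, h6 x _ (hα x) a ha]; exact haC

abbrev posO (d : ℕ) : Set (Fin d → ℝ) := {x | ∀ i, 0 < x i}

lemma measurableSet_posO (d : ℕ) : MeasurableSet (posO d) := by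
  have : posO d = ⋂ i, {x | 0 < x i} := by ext; simp
  rw [this]
  exact MeasurableSet.iInter fun i => measurableSet_lt measurable_const (measurable_pi_apply i)

/-- One-step expectation. -/
noncomputable def stepJ (d : ℕ) (T r : ℝ) (N : ℕ) (W : (Fin d → ℝ) → ℝ)
    (x : Fin d → ℝ) (a : Matrix (Fin d) (Fin d) ℝ) : ℝ :=
  ∫ z, W (logEuler d T r N x a z) ∂(stdGaussian d)

instance stdGaussianProb (d : ℕ) : IsProbabilityMeasure (stdGaussian d) := by
  unfold _root_.stdGaussian; infer_instance

lemma logEuler_pos {d : ℕ} {T r : ℝ} {N : ℕ} {x : Fin d → ℝ} (hx : x ∈ posO d)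
    (a : Matrix (Fin d) (Fin d) ℝ) (z : Fin d → ℝ) : logEuler d T r N x a z ∈ posO d :=
  fun i => mul_pos (hx i) (Real.exp_pos _)

lemma logEuler_cont (d : ℕ) (T r : ℝ) (N : ℕ) :
    Continuous (fun q : (Fin d → ℝ) × Matrix (Fin d) (Fin d) ℝ × (Fin d → ℝ) =>
      logEuler d T r N q.1 q.2.1 q.2.2) := by
  unfold logEuler
  refine continuous_pi fun i => ?_
  simp only [Matrix.mul_apply, Matrix.mulVec, dotProduct, Matrix.transpose_apply]
  fun_prop

/-- Integrable dominating function. -/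
noncomputable def domH (d : ℕ) (B D : ℝ) (z : Fin d → ℝ) : ℝ :=
  Real.exp (B + D * ∑ j, |z j|)

lemma domH_integrable (d : ℕ) (B D : ℝ) : Integrable (domH d B D) (stdGaussian d) := by
  have h1 : Integrable (fun z : ℝ => Real.exp (D * |z|)) (gaussianReal 0 1) := by
    have ha := (integrable_exp_mul_gaussianReal (μ := 0) (v := 1) D).add
      (integrable_exp_mul_gaussianReal (μ := 0) (v := 1) (-D))
    refine ha.mono' (by fun_prop) (ae_of_all _ fun z => ?_)
    rw [Real.norm_eq_abs, abs_of_pos (Real.exp_pos _)]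
    simp only [Pi.add_apply]
    rcases abs_cases z with ⟨h, _⟩ | ⟨h, _⟩ <;> rw [h]
    · linarith [Real.exp_pos (-D * z)]
    · rw [show D * -z = -D * z by ring]; linarith [Real.exp_pos (D * z)]
  have h2 := Integrable.fintype_prod (ι := Fin d) (f := fun _ (z : ℝ) => Real.exp (D * |z|))
    (μ := fun _ => gaussianReal 0 1) (fun _ => h1)
  have h3 := h2.const_mul (Real.exp B)
  refine h3.congr (ae_of_all _ fun z => ?_)
  simp only [domH]
  rw [Real.exp_add, Finset.mul_sum, Real.exp_sum]

/-- Weight comparison: existence of the dominating function. -/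
lemma weight_bound (d : ℕ) (T r : ℝ) (N : ℕ) (A : Set (Matrix (Fin d) (Fin d) ℝ))
    (hA : IsCompact A) (p : ℝ) (hp : 0 ≤ p) (hr : 0 ≤ r) (hT : 0 < T) :
    ∃ B D : ℝ, ∀ x ∈ posO d, ∀ a ∈ A, ∀ z,
      1 + ‖logEuler d T r N x a z‖ ^ p ≤ (1 + ‖x‖ ^ p) * domH d B D z := by
  obtain ⟨M, hM⟩ := hA.exists_bound_of_continuousOn
    (f := fun a : Matrix (Fin d) (Fin d) ℝ => (fun i j => a i j : Fin d → Fin d → ℝ))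
    (by fun_prop)
  have hTN : 0 ≤ T / N := by positivity
  set s := Real.sqrt (T / N) with hs
  have hs0 : 0 ≤ s := Real.sqrt_nonneg _
  refine ⟨p * (r * (T / N)), p * (s * |M|), fun x hx a ha z => ?_⟩
  set S := ∑ j, |z j| with hS
  have hS0 : 0 ≤ S := Finset.sum_nonneg fun _ _ => abs_nonneg _
  have hn : ‖logEuler d T r N x a z‖ ≤ ‖x‖ * Real.exp (r * (T / N) + s * |M| * S) := by
    rw [pi_norm_le_iff_of_nonneg (by positivity)]
    intro i
    simp only [logEuler]
    rw [norm_mul, Real.norm_eq_abs (Real.exp _), abs_of_pos (Real.exp_pos _)]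
    refine mul_le_mul (norm_le_pi_norm x i) (Real.exp_le_exp.2 (add_le_add ?_ ?_))
      (Real.exp_pos _).le (norm_nonneg _)
    · refine mul_le_mul_of_nonneg_right ?_ hTN
      have h0 : 0 ≤ (a * aᵀ) i i := by
        simp only [Matrix.mul_apply, Matrix.transpose_apply]
        exact Finset.sum_nonneg fun _ _ => mul_self_nonneg _
      linarith
    · rw [mul_assoc, ← hs]
      refine mul_le_mul_of_nonneg_left ?_ hs0
      rw [hS, Finset.mul_sum]
      simp only [Matrix.mulVec, dotProduct]
      refine Finset.sum_le_sum fun j _ => ?_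
      have hb : |a i j| ≤ |M| := by
        have e1 := norm_le_pi_norm (fun i j => a i j : Fin d → Fin d → ℝ) i
        have e2 := norm_le_pi_norm (fun j => a i j : Fin d → ℝ) j
        have e3 := hM a ha
        rw [Real.norm_eq_abs] at e2
        exact e2.trans (e1.trans (e3.trans (le_abs_self _)))
      calc a i j * z j ≤ |a i j * z j| := le_abs_self _
        _ = |a i j| * |z j| := abs_mul _ _
        _ ≤ _ := by gcongr
  have h1 : ‖logEuler d T r N x a z‖ ^ p ≤
      ‖x‖ ^ p * domH d (p * (r * (T / N))) (p * (s * |M|)) z := by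
    refine (Real.rpow_le_rpow (norm_nonneg _) hn hp).trans (le_of_eq ?_)
    rw [Real.mul_rpow (norm_nonneg _) (Real.exp_pos _).le, ← Real.exp_mul]
    simp only [domH]
    congr 2
    ring
  have h2 : 1 ≤ domH d (p * (r * (T / N))) (p * (s * |M|)) z := by
    simp only [domH]
    apply Real.one_le_exp
    positivity
  linarith

/-- The class of functions preserved by the Bellman operator. -/
def Nice (d : ℕ) (p : ℝ) (W : (Fin d → ℝ) → ℝ) : Prop :=
  ContinuousOn W (posO d) ∧ (∀ x ∈ posO d, 0 ≤ W x) ∧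
    ∃ C, 0 ≤ C ∧ ∀ x ∈ posO d, W x ≤ C * (1 + ‖x‖ ^ p)

lemma Nice.aesm {d : ℕ} {T r : ℝ} {N : ℕ} {p : ℝ} {W : (Fin d → ℝ) → ℝ} (hW : Nice d p W)
    {x : Fin d → ℝ} (hx : x ∈ posO d) (a : Matrix (Fin d) (Fin d) ℝ) :
    Continuous (fun z => W (logEuler d T r N x a z)) := by
  have h : Continuous (fun z => logEuler d T r N x a z) :=
    (logEuler_cont d T r N).comp (by fun_prop : Continuous fun z => (x, a, z))
  exact hW.1.comp_continuous h fun z => logEuler_pos hx a z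

section main
variable {d : ℕ} {T r : ℝ} {N : ℕ} {A : Set (Matrix (Fin d) (Fin d) ℝ)} {p B D : ℝ}

lemma Nice.integrable {W : (Fin d → ℝ) → ℝ} (hW : Nice d p W)
    (hB : ∀ x ∈ posO d, ∀ a ∈ A, ∀ z,
      1 + ‖logEuler d T r N x a z‖ ^ p ≤ (1 + ‖x‖ ^ p) * domH d B D z)
    {x : Fin d → ℝ} (hx : x ∈ posO d) {a : Matrix (Fin d) (Fin d) ℝ} (ha : a ∈ A) :
    Integrable (fun z => W (logEuler d T r N x a z)) (stdGaussian d) := by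
  obtain ⟨hc, hnn, C, hC, hb⟩ := id hW
  refine ((domH_integrable d B D).const_mul (C * (1 + ‖x‖ ^ p))).mono'
    (hW.aesm hx a).aestronglyMeasurable (ae_of_all _ fun z => ?_)
  rw [Real.norm_eq_abs, abs_of_nonneg (hnn _ (logEuler_pos hx a z))]
  refine (hb _ (logEuler_pos hx a z)).trans ?_
  rw [mul_assoc]
  exact mul_le_mul_of_nonneg_left (hB x hx a ha z) hC

lemma Nice.stepJ_nonneg {W : (Fin d → ℝ) → ℝ} (hW : Nice d p W)
    {x : Fin d → ℝ} (hx : x ∈ posO d) (a : Matrix (Fin d) (Fin d) ℝ) :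
    0 ≤ stepJ d T r N W x a :=
  integral_nonneg fun z => hW.2.1 _ (logEuler_pos hx a z)

lemma Nice.stepJ_le {W : (Fin d → ℝ) → ℝ} (hW : Nice d p W)
    (hB : ∀ x ∈ posO d, ∀ a ∈ A, ∀ z,
      1 + ‖logEuler d T r N x a z‖ ^ p ≤ (1 + ‖x‖ ^ p) * domH d B D z) :
    ∃ C, 0 ≤ C ∧ ∀ x ∈ posO d, ∀ a ∈ A, stepJ d T r N W x a ≤ C * (1 + ‖x‖ ^ p) := by
  obtain ⟨hc, hnn, C, hC, hb⟩ := id hW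
  refine ⟨C * ∫ z, domH d B D z ∂(stdGaussian d),
    mul_nonneg hC (integral_nonneg fun z => (Real.exp_pos _).le), fun x hx a ha => ?_⟩
  have : stepJ d T r N W x a ≤ ∫ z, C * (1 + ‖x‖ ^ p) * domH d B D z ∂(stdGaussian d) := by
    refine integral_mono (hW.integrable hB hx ha) ((domH_integrable d B D).const_mul _) ?_
    intro z
    refine (hb _ (logEuler_pos hx a z)).trans ?_
    beta_reduce
    rw [mul_assoc]
    exact mul_le_mul_of_nonneg_left (hB x hx a ha z) hC
  rw [integral_const_mul] at this
  linarith

lemma Nice.stepJ_cont {W : (Fin d → ℝ) → ℝ} (hW : Nice d p W) (hp : 0 ≤ p)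
    (hB : ∀ x ∈ posO d, ∀ a ∈ A, ∀ z,
      1 + ‖logEuler d T r N x a z‖ ^ p ≤ (1 + ‖x‖ ^ p) * domH d B D z) :
    Continuous (fun q : posO d × A => stepJ d T r N W q.1 q.2) := by
  obtain ⟨hc, hnn, C, hC, hb⟩ := id hW
  rw [continuous_iff_continuousAt]
  rintro ⟨x0, a0⟩
  have hw : Continuous (fun q : posO d × A => 1 + ‖(q.1 : Fin d → ℝ)‖ ^ p) := by
    refine continuous_const.add (Continuous.rpow_const (by fun_prop) fun _ => Or.inr hp)
  have hev := hw.continuousAt.eventually_lt (continuousAt_const (y := 1 + ‖(x0 : Fin d → ℝ)‖ ^ p + 1))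
    (x₀ := (x0, a0)) (by simp)
  refine continuousAt_of_dominated
    (bound := fun z => C * (1 + ‖(x0 : Fin d → ℝ)‖ ^ p + 1) * domH d B D z) ?_ ?_ ?_ ?_
  · exact Eventually.of_forall fun q => (hW.aesm q.1.2 _).aestronglyMeasurable
  · filter_upwards [hev] with q hq
    refine ae_of_all _ fun z => ?_
    rw [Real.norm_eq_abs, abs_of_nonneg (hnn _ (logEuler_pos q.1.2 _ z))]
    refine (hb _ (logEuler_pos q.1.2 _ z)).trans ?_
    rw [mul_assoc]
    refine mul_le_mul_of_nonneg_left ((hB _ q.1.2 _ q.2.2 z).trans ?_) hC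
    exact mul_le_mul_of_nonneg_right hq.le (Real.exp_pos _).le
  · exact (domH_integrable d B D).const_mul _
  · refine ae_of_all _ fun z => Continuous.continuousAt ?_
    refine hc.comp_continuous (f := fun q : posO d × A => logEuler d T r N q.1 q.2 z)
      ?_ fun q => logEuler_pos q.1.2 _ z
    exact (logEuler_cont d T r N).comp
      (by fun_prop : Continuous fun q : posO d × A =>
        ((q.1 : Fin d → ℝ), (q.2 : Matrix (Fin d) (Fin d) ℝ), z))

/-- Bellman operator. -/
noncomputable def bell (d : ℕ) (T r : ℝ) (N : ℕ) (A : Set (Matrix (Fin d) (Fin d) ℝ))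
    (W : (Fin d → ℝ) → ℝ) (x : Fin d → ℝ) : ℝ :=
  sSup (range fun a : A => stepJ d T r N W x a)

lemma Nice.le_bell {W : (Fin d → ℝ) → ℝ} (hW : Nice d p W)
    (hB : ∀ x ∈ posO d, ∀ a ∈ A, ∀ z,
      1 + ‖logEuler d T r N x a z‖ ^ p ≤ (1 + ‖x‖ ^ p) * domH d B D z)
    {x : Fin d → ℝ} (hx : x ∈ posO d) {a : Matrix (Fin d) (Fin d) ℝ} (ha : a ∈ A) :
    stepJ d T r N W x a ≤ bell d T r N A W x := by
  obtain ⟨C, hC, h⟩ := hW.stepJ_le hB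
  refine le_csSup ⟨C * (1 + ‖x‖ ^ p), ?_⟩ ⟨⟨a, ha⟩, rfl⟩
  rintro _ ⟨b, rfl⟩
  exact h x hx b b.2

lemma Nice.bell_cont {W : (Fin d → ℝ) → ℝ} (hW : Nice d p W) (hp : 0 ≤ p) (hA : IsCompact A)
    (hB : ∀ x ∈ posO d, ∀ a ∈ A, ∀ z,
      1 + ‖logEuler d T r N x a z‖ ^ p ≤ (1 + ‖x‖ ^ p) * domH d B D z) :
    Continuous (fun x : posO d => bell d T r N A W x) := by
  have : CompactSpace A := isCompact_iff_compactSpace.1 hA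
  have := IsCompact.continuous_sSup (K := (univ : Set A)) isCompact_univ
    (f := fun (x : posO d) (a : A) => stepJ d T r N W x a) (hW.stepJ_cont hp hB)
  simpa [bell, image_univ] using this

lemma Nice.bell {W : (Fin d → ℝ) → ℝ} (hW : Nice d p W) (hp : 0 ≤ p) (hA : IsCompact A)
    (hne : A.Nonempty)
    (hB : ∀ x ∈ posO d, ∀ a ∈ A, ∀ z,
      1 + ‖logEuler d T r N x a z‖ ^ p ≤ (1 + ‖x‖ ^ p) * domH d B D z) :
    Nice d p (bell d T r N A W) := by
  obtain ⟨a0, ha0⟩ := hne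
  have : Nonempty A := ⟨⟨a0, ha0⟩⟩
  refine ⟨continuousOn_iff_continuous_domRestrict.2 (hW.bell_cont hp hA hB), fun x hx => ?_, ?_⟩
  · exact (hW.stepJ_nonneg hx a0).trans (hW.le_bell hB hx ha0)
  · obtain ⟨C, hC, h⟩ := hW.stepJ_le hB
    refine ⟨C, hC, fun x hx => csSup_le (range_nonempty _) ?_⟩
    rintro _ ⟨b, rfl⟩
    exact h x hx b b.2

lemma Nice.selector {W : (Fin d → ℝ) → ℝ} (hW : Nice d p W) (hp : 0 ≤ p) (hA : IsCompact A)
    (hne : A.Nonempty)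
    (hB : ∀ x ∈ posO d, ∀ a ∈ A, ∀ z,
      1 + ‖logEuler d T r N x a z‖ ^ p ≤ (1 + ‖x‖ ^ p) * domH d B D z) :
    ∃ α : (Fin d → ℝ) → Matrix (Fin d) (Fin d) ℝ, Measurable α ∧ (∀ x, α x ∈ A) ∧
      ∀ x ∈ posO d, stepJ d T r N W x (α x) = _root_.bell d T r N A W x := by
  have : CompactSpace A := isCompact_iff_compactSpace.1 hA
  have hJ := hW.stepJ_cont hp hB
  have hM := hW.bell_cont hp hA hB
  let G : Set (posO d × A) := {q | _root_.bell d T r N A W q.1 ≤ stepJ d T r N W q.1 q.2}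
  have hG : IsClosed G := isClosed_le (hM.comp continuous_fst) hJ
  let K : posO d → Set (Matrix (Fin d) (Fin d) ℝ) := fun x => (↑) '' {a : A | (x, a) ∈ G}
  have hK : GoodSet K := by
    refine ⟨fun x => ?_, fun x => ?_, fun C hC => ?_⟩
    · exact ((hG.preimage (by fun_prop : Continuous fun a : A => (x, a))).isCompact).image
        continuous_subtype_val
    · have : Nonempty A := hne.to_subtype
      obtain ⟨a, _, ha⟩ := isCompact_univ.exists_isMaxOn (univ_nonempty (α := A))
        (f := fun a : A => stepJ d T r N W x a)
        (hJ.comp (by fun_prop : Continuous fun a : A => (x, a))).continuousOn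
      refine ⟨a, a, ?_, rfl⟩
      refine csSup_le (range_nonempty fun b : A => stepJ d T r N W x b) ?_
      rintro _ ⟨b, rfl⟩
      exact ha (mem_univ b)
    · have hcl : IsClosed (Prod.fst '' (G ∩ {q | (q.2 : Matrix (Fin d) (Fin d) ℝ) ∈ C})) :=
        isClosedMap_fst_of_compactSpace _
          (hG.inter (hC.preimage (by fun_prop :
            Continuous fun q : posO d × A => (q.2 : Matrix (Fin d) (Fin d) ℝ))))
      convert hcl.measurableSet using 1
      ext x
      constructor
      · rintro ⟨_, ⟨a, ha, rfl⟩, haC⟩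
        exact ⟨(x, a), ⟨ha, haC⟩, rfl⟩
      · rintro ⟨⟨x, a⟩, ⟨ha, haC⟩, rfl⟩
        exact ⟨a, ⟨a, ha, rfl⟩, haC⟩
  obtain ⟨β, hβ, hβK⟩ := hK.selector
  obtain ⟨a0, ha0⟩ := hne
  classical
  refine ⟨fun x => if h : x ∈ posO d then β ⟨x, h⟩ else a0, ?_, fun x => ?_, fun x hx => ?_⟩
  · exact Measurable.dite hβ measurable_const (measurableSet_posO d)
  · by_cases h : x ∈ posO d
    · simp only [h, dite_true]
      obtain ⟨a, _, e⟩ := hβK ⟨x, h⟩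
      rw [← e]; exact a.2
    · simp only [h, dite_false]; exact ha0
  · simp only [hx, dite_true]
    obtain ⟨a, h, e⟩ := hβK ⟨x, hx⟩
    rw [← e]
    exact le_antisymm (hW.le_bell hB hx a.2) h

end main

/-- Undiscounted value iteration. -/
noncomputable def valIt (d : ℕ) (T r : ℝ) (N : ℕ) (g : (Fin d → ℝ) → ℝ)
    (A : Set (Matrix (Fin d) (Fin d) ℝ)) : ℕ → (Fin d → ℝ) → ℝ
  | 0 => g
  | m + 1 => bell d T r N A (valIt d T r N g A m)

lemma polPay_le {d : ℕ} {T r : ℝ} {N : ℕ} {g : (Fin d → ℝ) → ℝ}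
    {A : Set (Matrix (Fin d) (Fin d) ℝ)} {p B D : ℝ} (hA : IsCompact A)
    (hB : ∀ x ∈ posO d, ∀ a ∈ A, ∀ z,
      1 + ‖logEuler d T r N x a z‖ ^ p ≤ (1 + ‖x‖ ^ p) * domH d B D z)
    (hN : ∀ m, Nice d p (valIt d T r N g A m))
    {π : ℕ → Kernel (Fin d → ℝ) (Matrix (Fin d) (Fin d) ℝ)} (hπ : IsPolicy A π) (m : ℕ) :
    ∀ x ∈ posO d, 0 ≤ polPay d T r N g π m x ∧
      polPay d T r N g π m x ≤ valIt d T r N g A m x := by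
  induction m with
  | zero => exact fun x hx => ⟨(hN 0).2.1 x hx, le_rfl⟩
  | succ m ih =>
    intro x hx
    have hnn : ∀ a, 0 ≤ ∫ z, polPay d T r N g π m (logEuler d T r N x a z) ∂(stdGaussian d) :=
      fun a => integral_nonneg fun z => (ih _ (logEuler_pos hx a z)).1
    obtain ⟨hmk, h1⟩ := hπ (N - (m + 1))
    have hae : ∀ᵐ a ∂(π (N - (m + 1)) x), a ∈ A :=
      (mem_ae_iff_prob_eq_one hA.measurableSet).2 (h1 x)
    refine ⟨integral_nonneg hnn, ?_⟩
    simp only [polPay]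
    calc _ ≤ ∫ _a, valIt d T r N g A (m + 1) x ∂(π (N - (m + 1)) x) := by
          refine integral_mono_of_nonneg (ae_of_all _ hnn) (integrable_const _) ?_
          filter_upwards [hae] with a ha
          refine le_trans ?_ ((hN m).le_bell hB hx ha)
          exact integral_mono_of_nonneg (ae_of_all _ fun z => (ih _ (logEuler_pos hx a z)).1)
            ((hN m).integrable hB hx ha) (ae_of_all _ fun z => (ih _ (logEuler_pos hx a z)).2)
      _ = _ := by simp

end helpers

/-- Discrete dynamic programming principle, measurable selector: for a
nonempty compact action set `A` and a continuous, nonnegative payoff `g` of polynomial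
growth, at each step `n < N` there is a Borel measurable selector `α_n^⋆` valued in `A`
such that `V_n(x) = ∫ e^{-rT/N} V_{n+1}(F(x, α_n^⋆(x), z)) dγ_d(z)` for all
`x ∈ (0,∞)^d`; in particular there exists an optimal Markov policy and it is
deterministic. -/
theorem discrete_dpp_measurable_selector
    (d : ℕ) (hd : 1 ≤ d) (T : ℝ) (hT : 0 < T) (r : ℝ) (hr : 0 ≤ r) (N : ℕ) (hN : 1 ≤ N)
    (A : Set (Matrix (Fin d) (Fin d) ℝ)) (hAne : A.Nonempty) (hAcomp : IsCompact A)
    (g : (Fin d → ℝ) → ℝ)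
    (hgc : ContinuousOn g {x | ∀ i, 0 < x i})
    (hgnn : ∀ y : Fin d → ℝ, (∀ i, 0 < y i) → 0 ≤ g y)
    (C p : ℝ) (hC : 0 ≤ C) (hp : 0 ≤ p)
    (hgrowth : ∀ y : Fin d → ℝ, (∀ i, 0 < y i) → |g y| ≤ C * (1 + ‖y‖ ^ p))
    (n : ℕ) (hn : n < N) :
    ∃ α : (Fin d → ℝ) → Matrix (Fin d) (Fin d) ℝ,
      Measurable α ∧ (∀ x, α x ∈ A) ∧
      ∀ x : Fin d → ℝ, (∀ i, 0 < x i) →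
        valueFn d T r N g A n x
          = ∫ z, Real.exp (-(r * T / N)) *
              valueFn d T r N g A (n + 1) (logEuler d T r N x (α x) z) ∂(stdGaussian d) := by
  obtain ⟨B, D, hB⟩ := weight_bound d T r N A hAcomp p hp hr hT
  have hNice : ∀ m, Nice d p (valIt d T r N g A m) := by
    intro m
    induction m with
    | zero => exact ⟨hgc, hgnn, C, hC, fun x hx => (le_abs_self _).trans (hgrowth x hx)⟩
    | succ m ih => exact ih.bell hp hAcomp hAne hB
  choose sel hsm hsA hsel using fun m => (hNice m).selector hp hAcomp hAne hB
  let π : ℕ → Kernel (Fin d → ℝ) (Matrix (Fin d) (Fin d) ℝ) := fun k =>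
    Kernel.deterministic (sel (N - k - 1)) (hsm _)
  have hπ : IsPolicy A π := by
    intro k
    refine ⟨by dsimp only [π]; infer_instance, fun x => ?_⟩
    simp only [π, Kernel.deterministic_apply]
    rw [Measure.dirac_apply' _ hAcomp.measurableSet]
    simp [hsA]
  have hopt : ∀ m, m ≤ N → ∀ x ∈ posO d,
      polPay d T r N g π m x = valIt d T r N g A m x := by
    intro m
    induction m with
    | zero => intro _ x _; rfl
    | succ m ih =>
      intro hm x hx
      have e : N - (N - (m + 1)) - 1 = m := by omega
      simp only [polPay, π, Kernel.deterministic_apply, integral_dirac, e]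
      refine Eq.trans ?_ (hsel m x hx)
      exact integral_congr_ae (ae_of_all _ fun z => ih (by omega) _ (logEuler_pos hx _ z))
  have hval : ∀ k, ∀ x ∈ posO d, valueFn d T r N g A k x =
      Real.exp (-(r * (T - (k : ℝ) * T / N))) * valIt d T r N g A (N - k) x := by
    intro k x hx
    refine IsGreatest.csSup_eq ⟨⟨π, hπ, ?_⟩, ?_⟩
    · rw [hopt _ (Nat.sub_le _ _) x hx]
    · rintro _ ⟨π', hπ', rfl⟩
      exact mul_le_mul_of_nonneg_left (polPay_le hAcomp hB hNice hπ' _ x hx).2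
        (Real.exp_pos _).le
  refine ⟨sel (N - (n + 1)), hsm _, hsA _, fun x hx => ?_⟩
  have e : N - n = N - (n + 1) + 1 := by omega
  have hN0 : (N : ℝ) ≠ 0 := by positivity
  rw [hval n x hx, e]
  simp only [valIt]
  rw [← hsel _ x hx, stepJ, ← integral_const_mul]
  refine integral_congr_ae (ae_of_all _ fun z => ?_)
  simp only
  rw [hval (n + 1) _ (logEuler_pos hx _ z), ← mul_assoc, ← Real.exp_add]
  congr 2
  push_cast
  field_simp
  ring
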